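/- Let H be a pre-SYK graph and {v, w} a disorder line of H such that v and w lie in distinct connected components of the multigraph H₀. Let H'' be the contraction of {v, w}: the pre-SYK graph with vertex set V(H) ∖ {v, w}, disorder pairing the restriction of π, and fermionic pairing which pairs τ(v,m) with τ(w,m) for each m = 1,…,q and agrees with τ on all darts not of the form τ(v,m) or τ(w,m). Then |V(H'')| = |V(H)| − 2 and F(H'') = F(H). -/

import Mathlib

namespace SYK

/-- A pre-SYK graph: a finite nonempty vertex set `V`, darts `V × Fin q`
(`Fin q` standing for the strand labels `{1,…,q}`), a fixed-point-free
involutive fermionic pairing `ferm` of the darts, and a fixed-point-free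
involutive disorder pairing `dis` of the vertices.  (Connectivity of the
fermionic multigraph is *not* required.) -/
structure PreGraph (q : ℕ) where
  V : Type
  [fintypeV : Fintype V]
  [decEqV : DecidableEq V]
  [nonemptyV : Nonempty V]
  ferm : Equiv.Perm (V × Fin q)
  dis : Equiv.Perm V
  ferm_invol : ∀ d, ferm (ferm d) = d
  ferm_fpf : ∀ d, ferm d ≠ d
  dis_invol : ∀ v, dis (dis v) = v
  dis_fpf : ∀ v, dis v ≠ v

attribute [instance] PreGraph.fintypeV PreGraph.decEqV PreGraph.nonemptyV

variable {q : ℕ}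

/-- The darts of a pre-SYK graph. -/
abbrev PreGraph.Dart (H : PreGraph q) : Type := H.V × Fin q

/-- Relabelling of darts induced by a map of vertices. -/
def dartMap {q : ℕ} {α β : Type} (ι : α → β) (d : α × Fin q) : β × Fin q :=
  (ι d.1, d.2)

/-- The involution `π̂` on darts induced by the disorder pairing:
`π̂ (v, m) = (π v, m)`. -/
def PreGraph.dishat (H : PreGraph q) : Equiv.Perm H.Dart :=
  Equiv.prodCongr H.dis (Equiv.refl (Fin q))

/-- Adjacency of vertices in the fermionic multigraph `G₀`, where fermionic
lines having a dart in `S` are deleted. -/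
def PreGraph.adj0Off (H : PreGraph q) (S : Set H.Dart) (v w : H.V) : Prop :=
  ∃ m m' : Fin q, (v, m) ∉ S ∧ H.ferm (v, m) = (w, m')

/-- Adjacency of vertices in the fermionic multigraph `G₀`. -/
def PreGraph.adj0 (H : PreGraph q) : H.V → H.V → Prop :=
  H.adj0Off ∅

/-- Connectivity of the fermionic multigraph `G₀`. -/
def PreGraph.Conn0 (H : PreGraph q) : Prop :=
  ∀ v w : H.V, Relation.ReflTransGen H.adj0 v w

/-- Adjacency of vertices in the multigraph `G⁺` (one edge per fermionic line
and one edge per disorder line), where fermionic lines having a dart in `S`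
are deleted. -/
def PreGraph.adjPlusOff (H : PreGraph q) (S : Set H.Dart) (v w : H.V) : Prop :=
  H.adj0Off S v w ∨ H.dis v = w

/-- The subgroup of dart permutations generated by the fermionic pairing `τ`
and the induced disorder involution `π̂`; faces are its orbits. -/
def PreGraph.faceGroup (H : PreGraph q) : Subgroup (Equiv.Perm H.Dart) :=
  Subgroup.closure {H.ferm, H.dishat}

/-- Two darts lie in a common face. -/
def PreGraph.SameFace (H : PreGraph q) (d₁ d₂ : H.Dart) : Prop :=
  d₁ ∈ MulAction.orbit H.faceGroup d₂

/-- `F H`: the number of faces, i.e. of orbits of `⟨τ, π̂⟩` on the darts. -/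
noncomputable def PreGraph.F (H : PreGraph q) : ℕ :=
  Nat.card (MulAction.orbitRel.Quotient H.faceGroup H.Dart)

/-- The number of vertices `|V(H)|`. -/
noncomputable def PreGraph.nV (H : PreGraph q) : ℕ :=
  Nat.card H.V

/-- `δ(H) = F(H) − (q−1)·|V(H)|/2` (the division is exact: `|V(H)|` is even). -/
noncomputable def PreGraph.delta (H : PreGraph q) : ℤ :=
  (H.F : ℤ) - ((q : ℤ) - 1) * ((H.nV / 2 : ℕ) : ℤ)

/-- `e` is a fermionic line: the set of the two darts of a `τ`-orbit. -/
def PreGraph.IsLine (H : PreGraph q) (e : Set H.Dart) : Prop :=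
  ∃ d : H.Dart, e = {d, H.ferm d}

/-- The fermionic lines `e₁` and `e₂` belong to a common face. -/
def PreGraph.LinesShareFace (H : PreGraph q) (e₁ e₂ : Set H.Dart) : Prop :=
  ∃ d₁ ∈ e₁, ∃ d₂ ∈ e₂, H.SameFace d₁ d₂

/-- Deleting the fermionic lines with a dart in `S` disconnects `G₀`. -/
def PreGraph.Disconnects0 (H : PreGraph q) (S : Set H.Dart) : Prop :=
  ¬ ∀ v w : H.V, Relation.ReflTransGen (H.adj0Off S) v w

/-- Deleting the fermionic lines with a dart in `S` disconnects `G⁺`. -/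
def PreGraph.DisconnectsPlus (H : PreGraph q) (S : Set H.Dart) : Prop :=
  ¬ ∀ v w : H.V, Relation.ReflTransGen (H.adjPlusOff S) v w

/-- `{e₁, e₂}` is a 2-cut of the multigraph `G⁺`. -/
def PreGraph.TwoCutPlus (H : PreGraph q) (e₁ e₂ : Set H.Dart) : Prop :=
  H.DisconnectsPlus (e₁ ∪ e₂)

/-- `{e₁, e₂}` is a 2-cut of the fermionic multigraph `G₀`. -/
def PreGraph.TwoCut0 (H : PreGraph q) (e₁ e₂ : Set H.Dart) : Prop :=
  H.Disconnects0 (e₁ ∪ e₂)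

/-- An SYK graph: a pre-SYK graph whose fermionic multigraph `G₀` is
connected. -/
structure Graph (q : ℕ) extends PreGraph q where
  conn : toPreGraph.Conn0

/-- `G` is (a relabelling of) the minimal graph `G_min`: two vertices `a, b`
with `π a = b` and `τ (a, m) = (b, m)` for all `m`. -/
def Graph.IsMin (G : Graph q) : Prop :=
  ∃ a b : G.V, a ≠ b ∧ (∀ v : G.V, v = a ∨ v = b) ∧ G.dis a = b ∧
    ∀ m : Fin q, G.ferm (a, m) = (b, m)

/-- `G'` is obtained from `G` by a melonic move: two new vertices `x, y` with
`π x = y` are inserted on a fermionic line `{d, τ d}` of `G`; the strand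
`⟨0, _⟩ : Fin q` plays the role of the label `1` of `{1,…,q}`. -/
def Graph.MelonicMove (G G' : Graph q) : Prop :=
  ∃ (x y : G'.V) (ι : G.V → G'.V) (d : G.V × Fin q),
    Function.Injective ι ∧ x ≠ y ∧
    (∀ v' : G'.V, (¬ ∃ v, ι v = v') ↔ (v' = x ∨ v' = y)) ∧
    G'.dis x = y ∧
    (∀ v, G'.dis (ι v) = ι (G.dis v)) ∧
    G'.ferm (dartMap ι d) = (x, ⟨0, d.2.pos⟩) ∧
    G'.ferm (y, ⟨0, d.2.pos⟩) = dartMap ι (G.ferm d) ∧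
    (∀ k : Fin q, k ≠ ⟨0, d.2.pos⟩ → G'.ferm (x, k) = (y, k)) ∧
    (∀ d' : G.V × Fin q, d' ≠ d → d' ≠ G.ferm d →
      G'.ferm (dartMap ι d') = dartMap ι (G.ferm d'))

/-- Isomorphism of SYK graphs: a bijection of darts commuting with the
fermionic pairings and the induced disorder involutions, and mapping the `q`
darts of each vertex onto the `q` darts of a single vertex. -/
def Graph.Isomorphic (G G' : Graph q) : Prop :=
  ∃ φ : (G.V × Fin q) ≃ (G'.V × Fin q),
    (∀ d, φ (G.ferm d) = G'.ferm (φ d)) ∧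
    (∀ d, φ (G.toPreGraph.dishat d) = G'.toPreGraph.dishat (φ d)) ∧
    ∀ v : G.V, ∃ v' : G'.V, ∀ m : Fin q, (φ (v, m)).1 = v'

/-- `G` is melonic: isomorphic to a graph obtained from the minimal graph
`G_min` by a finite sequence of melonic moves. -/
def Graph.IsMelonic (G : Graph q) : Prop :=
  ∃ G₀ Gn : Graph q, G₀.IsMin ∧ Relation.ReflTransGen Graph.MelonicMove G₀ Gn ∧
    G.Isomorphic Gn


/-- The pre-SYK graph obtained from `H` by replacing the fermionic pairing,
keeping the vertex set and the disorder pairing. -/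
def PreGraph.withFerm (H : PreGraph q) (f : Equiv.Perm (H.V × Fin q))
    (hi : ∀ d, f (f d) = d) (hf : ∀ d, f d ≠ d) : PreGraph q where
  V := H.V
  fintypeV := H.fintypeV
  decEqV := H.decEqV
  nonemptyV := H.nonemptyV
  ferm := f
  dis := H.dis
  ferm_invol := hi
  ferm_fpf := hf
  dis_invol := H.dis_invol
  dis_fpf := H.dis_fpf

/-- `G` is the gluing `G₁^{(e₁)} ⋆ G₂^{(e₂)}` where `e₁ = {d₁, τ₁ d₁}` and
`e₂ = {d₂, τ₂ d₂}`: the vertex set is the disjoint union of those of `G₁` and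
`G₂`, the disorder pairing is the union of the two disorder pairings, and the
fermionic pairing agrees with `τ₁`, `τ₂` outside `e₁ ∪ e₂` and pairs `d₁` with
`d₂`, and `τ₁ d₁` with `τ₂ d₂`. -/
def Graph.IsStarGluing (G₁ G₂ G : Graph q) (d₁ : G₁.V × Fin q)
    (d₂ : G₂.V × Fin q) : Prop :=
  ∃ (ι₁ : G₁.V → G.V) (ι₂ : G₂.V → G.V),
    Function.Injective ι₁ ∧ Function.Injective ι₂ ∧
    (∀ v₁ v₂, ι₁ v₁ ≠ ι₂ v₂) ∧
    (∀ v : G.V, (∃ v₁, ι₁ v₁ = v) ∨ (∃ v₂, ι₂ v₂ = v)) ∧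
    (∀ v, G.dis (ι₁ v) = ι₁ (G₁.dis v)) ∧
    (∀ v, G.dis (ι₂ v) = ι₂ (G₂.dis v)) ∧
    G.ferm (dartMap ι₁ d₁) = dartMap ι₂ d₂ ∧
    G.ferm (dartMap ι₁ (G₁.ferm d₁)) = dartMap ι₂ (G₂.ferm d₂) ∧
    (∀ d, d ≠ d₁ → d ≠ G₁.ferm d₁ →
      G.ferm (dartMap ι₁ d) = dartMap ι₁ (G₁.ferm d)) ∧
    (∀ d, d ≠ d₂ → d ≠ G₂.ferm d₂ →
      G.ferm (dartMap ι₂ d) = dartMap ι₂ (G₂.ferm d))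

/-- `G` is the gluing `G₁^{(e₁)} ⋆̄ G₂^{(e₂)}`: as in `IsStarGluing` but the
fermionic pairing pairs `d₁` with `τ₂ d₂`, and `τ₁ d₁` with `d₂`. -/
def Graph.IsBarGluing (G₁ G₂ G : Graph q) (d₁ : G₁.V × Fin q)
    (d₂ : G₂.V × Fin q) : Prop :=
  ∃ (ι₁ : G₁.V → G.V) (ι₂ : G₂.V → G.V),
    Function.Injective ι₁ ∧ Function.Injective ι₂ ∧
    (∀ v₁ v₂, ι₁ v₁ ≠ ι₂ v₂) ∧
    (∀ v : G.V, (∃ v₁, ι₁ v₁ = v) ∨ (∃ v₂, ι₂ v₂ = v)) ∧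
    (∀ v, G.dis (ι₁ v) = ι₁ (G₁.dis v)) ∧
    (∀ v, G.dis (ι₂ v) = ι₂ (G₂.dis v)) ∧
    G.ferm (dartMap ι₁ d₁) = dartMap ι₂ (G₂.ferm d₂) ∧
    G.ferm (dartMap ι₁ (G₁.ferm d₁)) = dartMap ι₂ d₂ ∧
    (∀ d, d ≠ d₁ → d ≠ G₁.ferm d₁ →
      G.ferm (dartMap ι₁ d) = dartMap ι₁ (G₁.ferm d)) ∧
    (∀ d, d ≠ d₂ → d ≠ G₂.ferm d₂ →
      G.ferm (dartMap ι₂ d) = dartMap ι₂ (G₂.ferm d))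

/-- `H''` is the contraction of the disorder line `{v, w}` of `H`: its vertex
set is `V(H) ∖ {v, w}` (embedded via `ι`), its disorder pairing is the
restriction of that of `H`, and its fermionic pairing pairs `τ (v, m)` with
`τ (w, m)` for each strand `m` and agrees with `τ` on all other darts. -/
def PreGraph.IsContraction (H H'' : PreGraph q) (v w : H.V) : Prop :=
  ∃ ι : H''.V → H.V,
    Function.Injective ι ∧
    (∀ u : H.V, (∃ u'', ι u'' = u) ↔ (u ≠ v ∧ u ≠ w)) ∧
    (∀ u, ι (H''.dis u) = H.dis (ι u)) ∧
    (∀ m : Fin q, ∃ a b : H''.V × Fin q,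
      dartMap ι a = H.ferm (v, m) ∧ dartMap ι b = H.ferm (w, m) ∧
      H''.ferm a = b) ∧
    (∀ d : H''.V × Fin q,
      (∀ m : Fin q, dartMap ι d ≠ H.ferm (v, m) ∧ dartMap ι d ≠ H.ferm (w, m)) →
      dartMap ι (H''.ferm d) = H.ferm (dartMap ι d))

/-- `HL` is the closure of the side `side ⊆ V(G)` of the graph `G` cut along
the fermionic lines `e₁, e₂`: its vertex set is `{v | side v}` (embedded via
`ι`), its disorder pairing is the restriction of that of `G`, and its
fermionic pairing pairs the `side`-dart of `e₁` with the `side`-dart of `e₂`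
and agrees with `τ` on all darts not in `e₁ ∪ e₂`. -/
def Graph.IsSideClose (G : Graph q) (side : G.V → Prop)
    (e₁ e₂ : Set (G.V × Fin q)) (HL : PreGraph q) : Prop :=
  ∃ ι : HL.V → G.V,
    Function.Injective ι ∧
    (∀ v : G.V, (∃ u, ι u = v) ↔ side v) ∧
    (∀ u, ι (HL.dis u) = G.dis (ι u)) ∧
    (∃ a b : HL.V × Fin q, dartMap ι a ∈ e₁ ∧ dartMap ι b ∈ e₂ ∧
      HL.ferm a = b) ∧
    (∀ d : HL.V × Fin q, dartMap ι d ∉ e₁ ∪ e₂ →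
      dartMap ι (HL.ferm d) = G.ferm (dartMap ι d))


/-- A function invariant under a generating set is constant on orbits of the generated group. -/
theorem eq_of_mem_orbit_closure {α γ : Type*} {S : Set (Equiv.Perm α)} {f : α → γ}
    (hf : ∀ g ∈ S, ∀ x, f (g x) = f x) {x y : α}
    (h : x ∈ MulAction.orbit (Subgroup.closure S) y) : f x = f y := by
  obtain ⟨⟨g, hg⟩, rfl⟩ := h
  change f (g y) = f y
  induction hg using Subgroup.closure_induction generalizing y with
  | mem g hg => exact hf g hg y
  | one => rfl
  | mul g k _ _ ihg ihk => rw [Equiv.Perm.mul_apply, ihg, ihk]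
  | inv g _ ih => simpa using (ih (y := g⁻¹ y)).symm

/-- The face containing a dart. -/
def PreGraph.face (H : PreGraph q) (d : H.Dart) :
    MulAction.orbitRel.Quotient H.faceGroup H.Dart :=
  Quotient.mk _ d

theorem PreGraph.face_eq_of_mem (H : PreGraph q) {g : Equiv.Perm H.Dart}
    (hg : g ∈ H.faceGroup) (d : H.Dart) : H.face (g d) = H.face d :=
  Quotient.sound (s := MulAction.orbitRel H.faceGroup H.Dart) ⟨⟨g, hg⟩, rfl⟩

theorem PreGraph.face_ferm (H : PreGraph q) (d : H.Dart) : H.face (H.ferm d) = H.face d :=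
  H.face_eq_of_mem (Subgroup.subset_closure (by simp)) d

theorem PreGraph.face_dishat (H : PreGraph q) (d : H.Dart) : H.face (H.dishat d) = H.face d :=
  H.face_eq_of_mem (Subgroup.subset_closure (by simp)) d

/-- A dart function invariant under both involutions descends to faces. -/
def PreGraph.faceLift (H : PreGraph q) {γ : Type*} (f : H.Dart → γ)
    (hferm : ∀ d, f (H.ferm d) = f d) (hdis : ∀ d, f (H.dishat d) = f d) :
    MulAction.orbitRel.Quotient H.faceGroup H.Dart → γ :=
  Quotient.lift f fun _ _ h => eq_of_mem_orbit_closure (by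
    rintro g (rfl | rfl)
    exacts [hferm, hdis]) h

/-- Two graphs have the same number of faces if there are dart maps in both directions that
respect faces and are mutually inverse up to faces. -/
theorem PreGraph.F_eq_of_dart_maps (H K : PreGraph q) (f : K.Dart → H.Dart) (s : H.Dart → K.Dart)
    (hf_ferm : ∀ d, H.face (f (K.ferm d)) = H.face (f d))
    (hf_dis : ∀ d, H.face (f (K.dishat d)) = H.face (f d))
    (hs_ferm : ∀ x, K.face (s (H.ferm x)) = K.face (s x))
    (hs_dis : ∀ x, K.face (s (H.dishat x)) = K.face (s x))
    (hsf : ∀ d, K.face (s (f d)) = K.face d) (hfs : ∀ x, H.face (f (s x)) = H.face x) :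
    K.F = H.F :=
  Nat.card_congr
    { toFun := K.faceLift (fun d => H.face (f d)) hf_ferm hf_dis
      invFun := H.faceLift (fun x => K.face (s x)) hs_ferm hs_dis
      left_inv := by
        rintro ⟨d⟩
        exact hsf d
      right_inv := by
        rintro ⟨x⟩
        exact hfs x }

theorem PreGraph.IsContraction.nV_add_two {H K : PreGraph q} {v w : H.V} (hne : v ≠ w)
    (h : H.IsContraction K v w) : K.nV + 2 = H.nV := by
  obtain ⟨ι, hι, hran, -⟩ := h
  have himg : Finset.univ.image ι = ({v, w} : Finset H.V)ᶜ := by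
    ext u
    simpa using hran u
  have hcard := Finset.card_add_card_compl ({v, w} : Finset H.V)
  rw [← himg, Finset.card_image_of_injective _ hι, Finset.card_pair hne, Finset.card_univ] at hcard
  simp only [PreGraph.nV, Nat.card_eq_fintype_card]
  omega

theorem PreGraph.IsContraction.F_eq {H K : PreGraph q} {v w : H.V} (hvw : H.dis v = w)
    (h : H.IsContraction K v w) : K.F = H.F := by
  obtain ⟨ι, hι, hran, hdis, hline, hoff⟩ := h
  choose a b ha hb hab using hline
  have hinj : Function.Injective (dartMap (q := q) ι) := fun x y hxy =>
    Prod.ext (hι (congrArg Prod.fst hxy)) (congrArg (fun p => p.2) hxy)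
  have hba : ∀ m, K.ferm (b m) = a m := fun m => by rw [← hab, K.ferm_invol]
  have hπ : ∀ d, dartMap ι (K.dishat d) = H.dishat (dartMap ι d) := fun d =>
    Prod.ext (hdis d.1) rfl
  have hπv : ∀ m, H.dishat (v, m) = (w, m) := fun m => Prod.ext hvw rfl
  have hπw : ∀ m, H.dishat (w, m) = (v, m) := fun m =>
    Prod.ext (by rw [← hvw]; exact H.dis_invol v) rfl
  have hcover : ∀ x : H.Dart, (∃ m, x = (v, m)) ∨ (∃ m, x = (w, m)) ∨ ∃ d, x = dartMap ι d := by
    rintro ⟨u, m⟩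
    by_cases hv : u = v
    · exact .inl ⟨m, by rw [hv]⟩
    by_cases hw : u = w
    · exact .inr (.inl ⟨m, by rw [hw]⟩)
    obtain ⟨u', rfl⟩ := (hran u).2 ⟨hv, hw⟩
    exact .inr (.inr ⟨(u', m), rfl⟩)
  have hretract : ∀ x : H.Dart, ∃ d : K.Dart,
      dartMap ι d = x ∨ ((x.1 = v ∨ x.1 = w) ∧ dartMap ι d = H.ferm x) := by
    intro x
    rcases hcover x with ⟨m, rfl⟩ | ⟨m, rfl⟩ | ⟨d, rfl⟩
    · exact ⟨a m, .inr ⟨.inl rfl, ha m⟩⟩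
    · exact ⟨b m, .inr ⟨.inr rfl, hb m⟩⟩
    · exact ⟨d, .inl rfl⟩
  choose s hs using hretract
  have hran' : ∀ d : K.Dart, (dartMap ι d).1 ≠ v ∧ (dartMap ι d).1 ≠ w := fun d =>
    (hran _).1 ⟨d.1, rfl⟩
  have hsι : ∀ d, s (dartMap ι d) = d := by
    intro d
    rcases hs (dartMap ι d) with h | ⟨h | h, -⟩
    · exact hinj h
    · exact absurd h (hran' d).1
    · exact absurd h (hran' d).2
  have hsv : ∀ m, s (v, m) = a m := by
    intro m
    rcases hs (v, m) with h | ⟨-, h⟩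
    · exact absurd (congrArg Prod.fst h) (hran' _).1
    · exact hinj (h.trans (ha m).symm)
  have hsw : ∀ m, s (w, m) = b m := by
    intro m
    rcases hs (w, m) with h | ⟨-, h⟩
    · exact absurd (congrArg Prod.fst h) (hran' _).2
    · exact hinj (h.trans (hb m).symm)
  have hface_ab : ∀ m, K.face (b m) = K.face (a m) := fun m => by rw [← hab, K.face_ferm]
  have hface_vw : ∀ m, H.face (w, m) = H.face (v, m) := fun m => by rw [← hπv, H.face_dishat]
  have hcases : ∀ d : K.Dart, (∃ m, d = a m) ∨ (∃ m, d = b m) ∨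
      dartMap ι (K.ferm d) = H.ferm (dartMap ι d) := by
    intro d
    by_cases h₁ : ∃ m, d = a m
    · exact .inl h₁
    by_cases h₂ : ∃ m, d = b m
    · exact .inr (.inl h₂)
    push Not at h₁ h₂
    exact .inr (.inr (hoff d fun m =>
      ⟨fun h => h₁ m (hinj (h.trans (ha m).symm)), fun h => h₂ m (hinj (h.trans (hb m).symm))⟩))
  refine PreGraph.F_eq_of_dart_maps H K (dartMap ι) s ?_ ?_ ?_ ?_ ?_ ?_
  · intro d
    rcases hcases d with ⟨m, rfl⟩ | ⟨m, rfl⟩ | h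
    · rw [hab, ha, hb, H.face_ferm, H.face_ferm, hface_vw]
    · rw [hba, ha, hb, H.face_ferm, H.face_ferm, hface_vw]
    · rw [h, H.face_ferm]
  · intro d
    rw [hπ, H.face_dishat]
  · intro x
    rcases hcover x with ⟨m, rfl⟩ | ⟨m, rfl⟩ | ⟨d, rfl⟩
    · rw [← ha, hsι, hsv]
    · rw [← hb, hsι, hsw]
    rcases hcases d with ⟨m, rfl⟩ | ⟨m, rfl⟩ | h
    · rw [hsι, ha, H.ferm_invol, hsv]
    · rw [hsι, hb, H.ferm_invol, hsw]
    · rw [← h, hsι, hsι, K.face_ferm]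
  · intro x
    rcases hcover x with ⟨m, rfl⟩ | ⟨m, rfl⟩ | ⟨d, rfl⟩
    · rw [hπv, hsv, hsw, hface_ab]
    · rw [hπw, hsv, hsw, hface_ab]
    · rw [← hπ, hsι, hsι, K.face_dishat]
  · intro d
    rw [hsι]
  · intro x
    rcases hs x with h | ⟨-, h⟩
    · rw [h]
    · rw [h, H.face_ferm]

/-- Let `H` be a pre-SYK graph and `{v, w}` a disorder line
of `H` such that `v` and `w` lie in distinct connected components of the
fermionic multigraph `H₀`. Then any contraction `H''` of `{v, w}` satisfies
`|V(H'')| = |V(H)| − 2` and `F(H'') = F(H)`. -/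
theorem syk_contraction_preserves_faces (q : ℕ) (hq : 2 ≤ q)
    (H : PreGraph q) (v w : H.V) (hvw : H.dis v = w)
    (hsep : ¬ Relation.ReflTransGen H.adj0 v w) :
    ∀ H'' : PreGraph q, H.IsContraction H'' v w →
      H''.nV + 2 = H.nV ∧ H''.F = H.F := by
  intro K hK
  exact ⟨hK.nV_add_two fun h => H.dis_fpf v (hvw.trans h.symm), hK.F_eq hvw⟩

end SYK
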